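/- arXiv:1901.01367 — 3 statements merged into one kernel-verified Lean document; each statement's English description precedes it below -/
import Mathlib

section
/- Let p, q ∈ ℤ² with q ∧ p ≠ 0, let α ≥ 0, and assume q is of type I₋ relative to p, i.e. ‖q‖ < ‖p‖, ‖q − p‖ = ‖p‖, and ‖q + n·p‖ > ‖p‖ for every integer n ∉ {0,−1}. Then there exist a real number λ > 0 and a square-summable sequence w : ℤ → ℝ, not identically zero, such that ρ_{n−1} w_{n−1} − ρ_{n+1} w_{n+1} = λ w_n for all n ∈ ℤ. -/
open Filter Topology

/-- Euclidean norm of a point of the integer lattice `ℤ²`. -/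
noncomputable def znorm (v : ℤ × ℤ) : ℝ := Real.sqrt ((v.1 : ℝ) ^ 2 + (v.2 : ℝ) ^ 2)

/-- The wedge product `q ∧ p = q₁p₂ − q₂p₁`. -/
def wedge (q p : ℤ × ℤ) : ℤ := q.1 * p.2 - q.2 * p.1

/-- The coefficients `ρ_n` of the linearized α-Euler operator `L_{B,q}`. -/
noncomputable def rho (p q : ℤ × ℤ) (α : ℝ) (n : ℤ) : ℝ :=
  1 - (znorm p ^ 2 * (1 + α ^ 2 * znorm p ^ 2)) /
      (znorm (q + n • p) ^ 2 * (1 + α ^ 2 * znorm (q + n • p) ^ 2))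

/-- The finite continued fraction `l a₀ + 1 / (l a₁ + 1 / (⋯ + 1 / t))` with `N` levels. -/
noncomputable def finiteContFrac (t l : ℝ) : ℕ → (ℕ → ℝ) → ℝ
  | 0, _ => t
  | N + 1, a => l * a 0 + 1 / finiteContFrac t l N (fun k => a (k + 1))

theorem finiteContFrac_pos {t l : ℝ} (ht : 0 < t) (hl : 0 < l) (N : ℕ) :
    ∀ {a : ℕ → ℝ}, (∀ k, 1 ≤ a k) → 0 < finiteContFrac t l N a := by
  induction N with
  | zero => intro a _; exact ht
  | succ N ih =>
    intro a ha
    have h1 := ih (a := fun k => a (k + 1)) (fun k => ha (k + 1))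
    have h2 : 0 < a 0 := one_pos.trans_le (ha 0)
    simp only [finiteContFrac]
    positivity

theorem le_finiteContFrac {t l b : ℝ} (hb : 0 < b) (hbt : b ≤ t) (hbl : b ≤ l) (N : ℕ)
    {a : ℕ → ℝ} (ha : ∀ k, 1 ≤ a k) : b ≤ finiteContFrac t l N a := by
  cases N with
  | zero => exact hbt
  | succ N =>
    have h1 := finiteContFrac_pos (hb.trans_le hbt) (hb.trans_le hbl) N
      (a := fun k => a (k + 1)) (fun k => ha (k + 1))
    have h2 : l ≤ l * a 0 := le_mul_of_one_le_right (hb.trans_le hbl).le (ha 0)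
    have h3 : 0 < 1 / finiteContFrac t l N (fun k => a (k + 1)) := by positivity
    simp only [finiteContFrac]
    linarith

theorem finiteContFrac_le {t l b L A : ℝ} (hb : 0 < b) (hbt : b ≤ t) (hbl : b ≤ l)
    (hlL : l ≤ L) (N : ℕ) {a : ℕ → ℝ} (ha : ∀ k, 1 ≤ a k) (hA : ∀ k, a k ≤ A) :
    finiteContFrac t l N a ≤ t + L * A + 1 / b := by
  have ht : 0 < t := hb.trans_le hbt
  have hl : 0 < l := hb.trans_le hbl
  have hA0 : 0 < A := by linarith [ha 0, hA 0]
  have hlA : l * a 0 ≤ L * A :=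
    mul_le_mul hlL (hA 0) (by linarith [ha 0]) (hl.le.trans hlL)
  have hL : 0 < L := hl.trans_le hlL
  cases N with
  | zero =>
    have : 0 < L * A + 1 / b := by positivity
    simp only [finiteContFrac]
    linarith
  | succ N =>
    have h1 := le_finiteContFrac hb hbt hbl N
      (a := fun k => a (k + 1)) (fun k => ha (k + 1))
    have h2 := one_div_le_one_div_of_le hb h1
    simp only [finiteContFrac]
    linarith

theorem finiteContFrac_mem_Icc {m l A : ℝ} (hm : 0 < m) (hl : 0 < l) (hA1 : 1 ≤ A)
    (hml : m = l + 1 / (m * A)) (N : ℕ) :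
    ∀ {a : ℕ → ℝ}, (∀ k, 1 ≤ a k) → (∀ k, a k ≤ A) →
      finiteContFrac m l N a ∈ Set.Icc m (m * A) := by
  induction N with
  | zero => intro a _ _; exact ⟨le_rfl, le_mul_of_one_le_right hm.le hA1⟩
  | succ N ih =>
    intro a ha hA
    obtain ⟨h1, h2⟩ := ih (a := fun k => a (k + 1)) (fun k => ha (k + 1)) (fun k => hA (k + 1))
    have h3 := one_div_le_one_div_of_le hm h1
    have h4 := one_div_le_one_div_of_le (hm.trans_le h1) h2
    have h5 : l ≤ l * a 0 := le_mul_of_one_le_right hl.le (ha 0)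
    have h6 : l * a 0 ≤ l * A := mul_le_mul_of_nonneg_left (hA 0) hl.le
    have h7 : m * A = l * A + 1 / m := by
      conv_lhs => rw [hml]
      have : A ≠ 0 := by positivity
      field_simp
    simp only [finiteContFrac, Set.mem_Icc]
    constructor <;> linarith

theorem continuousOn_finiteContFrac {t : ℝ} (ht : 0 < t) (N : ℕ) :
    ∀ {a : ℕ → ℝ}, (∀ k, 1 ≤ a k) →
      ContinuousOn (fun l => finiteContFrac t l N a) (Set.Ioi 0) := by
  induction N with
  | zero => intro a _; exact continuousOn_const
  | succ N ih =>
    intro a ha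
    have h1 := ih (a := fun k => a (k + 1)) (fun k => ha (k + 1))
    simp only [finiteContFrac]
    refine (continuousOn_id.mul continuousOn_const).add (continuousOn_const.div h1 ?_)
    intro l hl
    exact (finiteContFrac_pos ht hl N (fun k => ha (k + 1))).ne'

theorem exists_pos_eq_add_one_div {l A : ℝ} (hl : 0 < l) (hl1 : l ≤ 1) (hA : 1 ≤ A) :
    ∃ m : ℝ, 0 < m ∧ m ≤ 2 ∧ m = l + 1 / (m * A) := by
  have hA0 : 0 < A := by linarith
  set s := √(l ^ 2 + 4 / A)
  have hs2 : s ^ 2 = l ^ 2 + 4 / A := Real.sq_sqrt (by positivity)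
  have hs0 : 0 ≤ s := Real.sqrt_nonneg _
  have h4 : 4 / A ≤ 4 := div_le_self (by norm_num) hA
  refine ⟨(l + s) / 2, by positivity, by nlinarith, ?_⟩
  have h0 : l + s ≠ 0 := by positivity
  field_simp at hs2 ⊢
  nlinarith

/-- The infinite continued fraction `u₀ = l a₀ + 1 / (l a₁ + ⋯)` satisfies `l u₀ = c` for some
`l > 0`. -/
theorem exists_contFrac_tails {a : ℕ → ℝ} {A c : ℝ} (ha : ∀ k, 1 ≤ a k) (hA : ∀ k, a k ≤ A)
    (hc : 0 < c) :
    ∃ l : ℝ, 0 < l ∧ ∃ u : ℕ → ℝ, (∀ n, 0 < u n) ∧ l * u 0 = c ∧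
      ∀ n, u n = l * a n + 1 / u (n + 1) := by
  have hA1 : 1 ≤ A := (ha 0).trans (hA 0)
  have hA0 : 0 < A := by linarith
  set b := min 1 (c / (2 * A))
  have hb0 : 0 < b := lt_min one_pos (by positivity)
  have hb1 : b ≤ 1 := min_le_left _ _
  have hbc : b * (2 * A) ≤ c := (le_div_iff₀ (by positivity)).1 (min_le_right _ _)
  obtain ⟨m, hm, hm2, hml⟩ := exists_pos_eq_add_one_div hb0 hb1 hA1
  have hbm : b ≤ m := by
    have : 0 < 1 / (m * A) := by positivity
    linarith
  set K : ℕ → Set (ℝ × (ℕ → ℝ)) := fun N =>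
    {x | (x.1 ∈ Set.Icc b (c + 1) ∧ ∀ n, x.2 n ∈ Set.Icc b (m + (c + 1) * A + 1 / b)) ∧
      x.1 * x.2 0 = c ∧ ∀ n < N, x.2 n * x.2 (n + 1) = x.1 * a n * x.2 (n + 1) + 1}
  have hbox : IsCompact {x : ℝ × (ℕ → ℝ) | x.1 ∈ Set.Icc b (c + 1) ∧
      ∀ n, x.2 n ∈ Set.Icc b (m + (c + 1) * A + 1 / b)} := by
    have h := (isCompact_Icc (a := b) (b := c + 1)).prod
      (isCompact_univ_pi (fun _ : ℕ => isCompact_Icc (a := b) (b := m + (c + 1) * A + 1 / b)))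
    convert h using 1
    ext x
    simp only [Set.mem_prod, Set.mem_univ_pi, Set.mem_ofPred_eq]
  have hclosed : ∀ N, IsClosed (K N) := by
    intro N
    have h1 : IsClosed {x : ℝ × (ℕ → ℝ) | x.1 * x.2 0 = c} :=
      isClosed_eq (by fun_prop) (by fun_prop)
    have h2 : IsClosed {x : ℝ × (ℕ → ℝ) |
        ∀ n < N, x.2 n * x.2 (n + 1) = x.1 * a n * x.2 (n + 1) + 1} := by
      simp only [Set.ofPred_forall]
      exact isClosed_iInter fun n => isClosed_iInter fun _ =>
        isClosed_eq (by fun_prop) (by fun_prop)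
    exact hbox.isClosed.inter (h1.inter h2)
  have hne : ∀ N, (K N).Nonempty := by
    intro N
    have hcont : ContinuousOn (fun l => l * finiteContFrac m l (N + 1) a) (Set.Icc b (c + 1)) :=
      continuousOn_id.mul ((continuousOn_finiteContFrac hm (N + 1) ha).mono
        fun l hl => hb0.trans_le hl.1)
    have hlow : b * finiteContFrac m b (N + 1) a ≤ c := by
      have h1 := (finiteContFrac_mem_Icc hm hb0 hA1 hml (N + 1) ha hA).2
      have h2 : m * A ≤ 2 * A := mul_le_mul_of_nonneg_right hm2 hA0.le
      exact (mul_le_mul_of_nonneg_left (h1.trans h2) hb0.le).trans hbc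
    have hhigh : c ≤ (c + 1) * finiteContFrac m (c + 1) (N + 1) a := by
      have h1 := finiteContFrac_pos hm (by linarith : 0 < c + 1) N (fun k => ha (k + 1))
      have h2 : 0 < 1 / finiteContFrac m (c + 1) N (fun k => a (k + 1)) := by positivity
      have h3 := ha 0
      have h4 : c + 1 ≤ (c + 1) * a 0 := le_mul_of_one_le_right (by linarith) h3
      simp only [finiteContFrac]
      exact (by linarith : c ≤ (c + 1) * a 0 + _).trans
        (le_mul_of_one_le_left (by linarith) (by linarith))
    obtain ⟨l, hl, hlc⟩ := intermediate_value_Icc (by linarith : b ≤ c + 1) hcont ⟨hlow, hhigh⟩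
    refine ⟨(l, fun n => finiteContFrac m l (N + 1 - n) (fun k => a (k + n))), ⟨hl, fun n =>
      ⟨le_finiteContFrac hb0 hbm hl.1 _ fun k => ha _,
        finiteContFrac_le hb0 hbm hl.1 hl.2 _ (fun k => ha _) fun k => hA _⟩⟩, hlc, ?_⟩
    intro n hn
    have h1 := finiteContFrac_pos hm (hb0.trans_le hl.1) (N + 1 - (n + 1))
      (a := fun k => a (k + (n + 1))) (fun k => ha _)
    have h2 : finiteContFrac m l (N + 1 - n) (fun k => a (k + n)) =
        l * a n + 1 / finiteContFrac m l (N + 1 - (n + 1)) (fun k => a (k + (n + 1))) := by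
      rw [show N + 1 - n = N + 1 - (n + 1) + 1 by omega]
      simp [finiteContFrac, add_assoc, add_comm 1 n]
    simp only [h2]
    field_simp
  obtain ⟨x, hx⟩ := IsCompact.nonempty_iInter_of_sequence_nonempty_isCompact_isClosed K
    (fun N x hx => ⟨hx.1, hx.2.1, fun n hn => hx.2.2 n (hn.trans N.lt_succ_self)⟩)
    hne (hbox.of_isClosed_subset (hclosed 0) fun x hx => hx.1) hclosed
  rw [Set.mem_iInter] at hx
  have hpos : ∀ n, 0 < x.2 n := fun n => hb0.trans_le ((hx 0).1.2 n).1
  refine ⟨x.1, hb0.trans_le (hx 0).1.1.1, x.2, hpos, (hx 0).2.1, fun n => ?_⟩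
  have h1 := (hx (n + 1)).2.2 n n.lt_succ_self
  have h2 := hpos (n + 1)
  field_simp
  linarith

theorem exists_summable_recurrence {a : ℕ → ℝ} {A c : ℝ} (ha : ∀ k, 1 ≤ a k)
    (hA : ∀ k, a k ≤ A) (hc : 0 < c) :
    ∃ l : ℝ, 0 < l ∧ ∃ z : ℕ → ℝ, z 0 = 1 ∧ c * z 1 = l ∧ (∀ n, 0 < z n) ∧
      (∀ n, z n - z (n + 2) = l * (a n * z (n + 1))) ∧
      Summable (fun n => a n * z (n + 1)) := by
  obtain ⟨l, hl, u, hu, hu0, hrec⟩ := exists_contFrac_tails ha hA hc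
  set z : ℕ → ℝ := fun n => ∏ i ∈ Finset.range n, (u i)⁻¹ with hz
  have hzpos : ∀ n, 0 < z n := fun n => Finset.prod_pos fun i _ => inv_pos.2 (hu i)
  have hsucc : ∀ n, z (n + 1) = z n * (u n)⁻¹ := fun n => Finset.prod_range_succ _ _
  have hstep : ∀ n, z n - z (n + 2) = l * (a n * z (n + 1)) := by
    intro n
    have h1 : z n = u n * z (n + 1) := by
      rw [hsucc]
      have := (hu n).ne'
      field_simp
    rw [h1, show n + 2 = n + 1 + 1 from rfl, hsucc (n + 1), hrec n]
    ring
  refine ⟨l, hl, z, by simp [hz], ?_, hzpos, hstep, ?_⟩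
  · have := (hu 0).ne'
    simp only [hz, Finset.prod_range_one, ← hu0]
    field_simp
  · refine summable_of_sum_range_le (c := (z 0 + z 1) / l)
      (fun n => mul_nonneg (by linarith [ha n]) (hzpos _).le) fun n => ?_
    have htel : l * ∑ i ∈ Finset.range n, a i * z (i + 1) = z 0 + z 1 - z n - z (n + 1) := by
      induction n with
      | zero => simp
      | succ n ih =>
        rw [Finset.sum_range_succ, mul_add, ih, ← hstep]
        ring
    rw [le_div_iff₀ hl]
    linarith [hzpos n, hzpos (n + 1)]

theorem znorm_sq (v : ℤ × ℤ) : znorm v ^ 2 = ((v.1 ^ 2 + v.2 ^ 2 : ℤ) : ℝ) := by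
  rw [znorm, Real.sq_sqrt (by positivity)]
  push_cast
  rfl

theorem znorm_nonneg (v : ℤ × ℤ) : 0 ≤ znorm v := Real.sqrt_nonneg _

theorem znorm_pos {v : ℤ × ℤ} (hv : v ≠ 0) : 0 < znorm v := by
  refine Real.sqrt_pos.2 ?_
  by_contra! h
  have h' : v.1 ^ 2 + v.2 ^ 2 ≤ 0 := by exact_mod_cast h
  refine hv (Prod.ext ?_ ?_)
  · exact pow_eq_zero_iff two_ne_zero |>.1 (by nlinarith [sq_nonneg v.1, sq_nonneg v.2])
  · exact pow_eq_zero_iff two_ne_zero |>.1 (by nlinarith [sq_nonneg v.1, sq_nonneg v.2])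

theorem znorm_sq_add_one_le {v w : ℤ × ℤ} (h : znorm v < znorm w) :
    znorm v ^ 2 + 1 ≤ znorm w ^ 2 := by
  have h2 : znorm v ^ 2 < znorm w ^ 2 := pow_lt_pow_left₀ h (znorm_nonneg v) two_ne_zero
  rw [znorm_sq, znorm_sq] at h2 ⊢
  exact_mod_cast h2

theorem rho_le_one (p q : ℤ × ℤ) (α : ℝ) (n : ℤ) : rho p q α n ≤ 1 :=
  sub_le_self _ (by positivity)

theorem rho_neg {p q : ℤ × ℤ} {α : ℝ} {n : ℤ} (h0 : q + n • p ≠ 0)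
    (h : znorm (q + n • p) < znorm p) : rho p q α n < 0 := by
  have h1 := znorm_pos h0
  rw [rho, sub_neg, one_lt_div (by positivity)]
  exact mul_lt_mul (by gcongr) (by gcongr) (by positivity) (by positivity)

theorem rho_eq_zero {p q : ℤ × ℤ} {α : ℝ} {n : ℤ} (hp : p ≠ 0)
    (h : znorm (q + n • p) = znorm p) : rho p q α n = 0 := by
  have h1 := znorm_pos hp
  rw [rho, h, div_self (by positivity), sub_self]

theorem exists_pos_le_rho (p q : ℤ × ℤ) (α : ℝ) :
    ∃ δ : ℝ, 0 < δ ∧ ∀ n, znorm p < znorm (q + n • p) → δ ≤ rho p q α n := by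
  set P := znorm p ^ 2 with hP
  have hP0 : 0 ≤ P := by positivity
  refine ⟨1 - (P * (1 + α ^ 2 * P)) / ((P + 1) * (1 + α ^ 2 * (P + 1))), ?_, fun n hn => ?_⟩
  · rw [sub_pos, div_lt_one (by positivity)]
    nlinarith [mul_nonneg (sq_nonneg α) hP0, sq_nonneg α]
  · have h := znorm_sq_add_one_le hn
    rw [← hP] at h
    rw [rho, ← hP]
    gcongr

/-- If `q` is of type `I₋` relative to `p`, the operator `L_{B,q}` has a positive
eigenvalue. -/
theorem unidirectional_instability_typeIminus
    (p q : ℤ × ℤ) (hwedge : wedge q p ≠ 0) (α : ℝ) (hα : 0 ≤ α)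
    (hq : znorm q < znorm p)
    (hqp : znorm (q - p) = znorm p)
    (hn : ∀ n : ℤ, n ≠ 0 → n ≠ -1 → znorm p < znorm (q + n • p)) :
    ∃ lam : ℝ, 0 < lam ∧ ∃ w : ℤ → ℝ,
      Summable (fun n : ℤ => (w n) ^ 2) ∧ w ≠ 0 ∧
      ∀ n : ℤ, rho p q α (n - 1) * w (n - 1) - rho p q α (n + 1) * w (n + 1) = lam * w n := by
  have hp0 : p ≠ 0 := by
    rintro rfl
    simp [wedge] at hwedge
  have hq0 : q ≠ 0 := by
    rintro rfl
    simp [wedge] at hwedge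
  have hrho0 : rho p q α 0 < 0 := rho_neg (by simpa using hq0) (by simpa using hq)
  have hrho1 : rho p q α (-1) = 0 := rho_eq_zero hp0 (by simpa [sub_eq_add_neg] using hqp)
  obtain ⟨δ, hδ, hle⟩ := exists_pos_le_rho p q α
  have hrho : ∀ k : ℕ, δ ≤ rho p q α (k + 1) := fun k =>
    hle _ (hn _ (by omega) (by omega))
  have hpos : ∀ k : ℕ, 0 < rho p q α (k + 1) := fun k => hδ.trans_le (hrho k)
  obtain ⟨l, hl, z, hz0, hz1, hz, hrec, hsum⟩ :=
    exists_summable_recurrence (a := fun k : ℕ => (rho p q α (k + 1))⁻¹) (A := δ⁻¹)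
      (fun k => (one_le_inv₀ (hpos k)).2 (rho_le_one _ _ _ _))
      (fun k => inv_anti₀ hδ (hrho k)) (neg_pos.2 hrho0)
  let w : ℤ → ℝ
    | Int.ofNat n => (rho p q α n)⁻¹ * z n
    | Int.negSucc 0 => -rho p q α 0 * ((rho p q α 0)⁻¹ * z 0) / l
    | Int.negSucc (_ + 1) => 0
  have hw0 : ∀ n : ℕ, w n = (rho p q α n)⁻¹ * z n := fun n => rfl
  have hw1 : w (-1) = -rho p q α 0 * w 0 / l := rfl
  have hw2 : ∀ n : ℕ, w (-(n + 2)) = 0 := fun n => by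
    rw [show (-(n + 2) : ℤ) = Int.negSucc (n + 1) by omega]
  have hrw : ∀ n : ℕ, rho p q α n * w n = z n := by
    intro n
    have : rho p q α n ≠ 0 := by
      cases n with
      | zero => exact hrho0.ne
      | succ n => exact_mod_cast (hpos n).ne'
    rw [hw0, mul_inv_cancel_left₀ this]
  refine ⟨l, hl, w, ?_, ?_, ?_⟩
  · refine Summable.of_nat_of_neg_add_one ?_ ?_
    · rw [← summable_nat_add_iff 1]
      have h1 : Summable fun n : ℕ => w ((n + 1 : ℕ) : ℤ) := by
        refine hsum.congr fun n => ?_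
        rw [hw0]
        push_cast
        rfl
      refine h1.of_norm_bounded_eventually_nat ?_
      filter_upwards [h1.tendsto_atTop_zero.eventually_le_const one_pos] with n hn1
      have h0 : 0 ≤ w ((n + 1 : ℕ) : ℤ) := by
        rw [hw0]
        exact mul_nonneg (inv_nonneg.2 (by exact_mod_cast (hpos n).le)) (hz _).le
      rw [Real.norm_of_nonneg (sq_nonneg _)]
      nlinarith
    · rw [← summable_nat_add_iff 1]
      refine summable_zero.congr fun n => ?_
      have := hw2 n
      rw [show (-(((n + 1 : ℕ) : ℤ) + 1)) = -((n : ℤ) + 2) by push_cast; ring, this]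
      norm_num
  · intro h
    have h0 := hrw 0
    rw [h] at h0
    simp [hz0] at h0
  · intro n
    obtain ⟨k, rfl⟩ | rfl | rfl | rfl | ⟨k, rfl⟩ : (∃ k : ℕ, n = k + 1) ∨ n = 0 ∨ n = -1 ∨
        n = -2 ∨ ∃ k : ℕ, n = -(k + 3) := by
      rcases n with (_ | k) | (_ | _ | k)
      · simp
      · exact Or.inl ⟨k, by simp⟩
      · simp
      · simp
      · exact Or.inr (Or.inr (Or.inr (Or.inr ⟨k, by omega⟩)))
    · have h1 := hrw k
      have h2 := hrw (k + 2)
      have h3 := hw0 (k + 1)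
      push_cast at h2 h3
      rw [add_sub_cancel_right, h1, add_assoc, one_add_one_eq_two, h2, hrec k, h3]
    · have h1 := hrw 1
      have h2 := hw0 0
      push_cast at h1 h2
      rw [zero_sub, zero_add, hrho1, h1, h2, hz0, ← hz1]
      have := hrho0.ne
      field_simp
      ring
    · have h1 := hw2 0
      norm_num at h1 ⊢
      rw [h1, hw1]
      field_simp
      ring
    · have h1 := hw2 0
      have h2 := hw2 1
      norm_num at h1 h2 ⊢
      rw [h1, h2, hrho1]
      simp
    · have h1 := hw2 (k + 2)
      have h2 := hw2 k
      have h3 := hw2 (k + 1)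
      push_cast at h1 h3
      rw [show (-(k + 3) - 1 : ℤ) = -(k + 2 + 2) by ring,
        show (-(k + 3) + 1 : ℤ) = -(k + 2) by ring,
        show (-(k + 3) : ℤ) = -(k + 1 + 2) by ring, h1, h2, h3]
      simp
end

section
/- Let (c_k)_{k≥1} be a sequence of positive reals with c_k → 1 as k → ∞, let x > 0, and suppose that for each n ≥ 1 the truncated continued fractions [x·c_n, x·c_{n+1}, …, x·c_{n+k}] converge as k → ∞ to a limit G_n(x). Then G_n(x) → √((x/2)² + 1) − x/2 as n → ∞. -/
open Filter Topology

/-- Finite continued fraction `[a₁, …, a_k]`, defined by `[a_k] = 1/a_k` and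
`[a_j, …, a_k] = 1/(a_j + [a_{j+1}, …, a_k])` (with the empty fraction equal to `0`). -/
noncomputable def cfrac : List ℝ → ℝ
  | [] => 0
  | a :: l => 1 / (a + cfrac l)

theorem cfrac_nonneg {l : List ℝ} (hl : ∀ a ∈ l, 0 ≤ a) : 0 ≤ cfrac l := by
  induction l with
  | nil => exact le_rfl
  | cons a l ih =>
    rw [List.forall_mem_cons] at hl
    exact one_div_nonneg.mpr (add_nonneg hl.1 (ih hl.2))

theorem cfrac_map_range_succ (f : ℕ → ℝ) (n k : ℕ) :
    cfrac ((List.range (k + 1)).map fun i => f (n + i)) =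
      1 / (f n + cfrac ((List.range k).map fun i => f (n + 1 + i))) := by
  simp [List.range_succ_eq_map, cfrac, Function.comp_def, add_assoc, add_comm 1]

/-- A bounded nonnegative sequence satisfying `d n ≤ e n + q * d (n + m)` with `0 ≤ q < 1` and
`e → 0` tends to zero. -/
theorem tendsto_zero_of_le_add_mul {d e : ℕ → ℝ} {q B : ℝ} {m : ℕ} (hq : 0 ≤ q) (hq1 : q < 1)
    (hd : ∀ n, 0 ≤ d n) (hB : ∀ᶠ n in atTop, d n ≤ B) (he : Tendsto e atTop (𝓝 0))
    (hde : ∀ᶠ n in atTop, d n ≤ e n + q * d (n + m)) : Tendsto d atTop (𝓝 0) := by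
  have h1q : 0 < 1 - q := sub_pos.mpr hq1
  refine tendsto_order.mpr ⟨fun a ha => .of_forall fun n => ha.trans_le (hd n), fun ε hε => ?_⟩
  have hsmall : ∀ᶠ n in atTop, e n < ε / 2 * (1 - q) :=
    he.eventually_lt_const (by positivity)
  obtain ⟨N, hN⟩ := eventually_atTop.mp (hB.and (hde.and hsmall))
  have key : ∀ k n, N ≤ n → d n ≤ ε / 2 + q ^ k * B := by
    intro k
    induction k with
    | zero => intro n hn; linarith [(hN n hn).1]
    | succ k ih =>
      intro n hn
      obtain ⟨-, h2, h3⟩ := hN n hn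
      have := mul_le_mul_of_nonneg_left (ih (n + m) (by omega)) hq
      rw [pow_succ]
      linarith
  have hpow : Tendsto (fun k : ℕ => ε / 2 + q ^ k * B) atTop (𝓝 (ε / 2 + 0 * B)) :=
    ((tendsto_pow_atTop_nhds_zero_of_lt_one hq hq1).mul_const B).const_add _
  filter_upwards [eventually_ge_atTop N] with n hn
  have := ge_of_tendsto' hpow fun k => key k n hn
  linarith

/-- If `c_k → 1` and the tails `G_n(x) = [xc_n, xc_{n+1}, …]` all converge, then
`G_n(x) → √((x/2)² + 1) − x/2` as `n → ∞`. -/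
theorem continued_fraction_tail_limit
    (c : ℕ → ℝ) (hc : ∀ k : ℕ, 1 ≤ k → 0 < c k)
    (hlim : Tendsto c atTop (nhds 1))
    (x : ℝ) (hx : 0 < x) (G : ℕ → ℝ)
    (hG : ∀ n : ℕ, 1 ≤ n →
      Tendsto (fun k : ℕ =>
          cfrac ((List.range (k + 1)).map fun i => x * c (n + i)))
        atTop (nhds (G n))) :
    Tendsto G atTop (nhds (Real.sqrt ((x / 2) ^ 2 + 1) - x / 2)) := by
  have hnonneg : ∀ n, 1 ≤ n → 0 ≤ G n := fun n hn =>
    ge_of_tendsto' (hG n hn) fun k => cfrac_nonneg fun a ha => by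
      obtain ⟨i, -, rfl⟩ := List.mem_map.mp ha
      exact (mul_pos hx (hc _ (by omega))).le
  have hrec : ∀ n, 1 ≤ n → G n * (x * c n + G (n + 1)) = 1 := by
    intro n hn
    have hpos : 0 < x * c n + G (n + 1) :=
      add_pos_of_pos_of_nonneg (mul_pos hx (hc n hn)) (hnonneg _ (by omega))
    have h1 := (hG n hn).comp (tendsto_add_atTop_nat 1)
    have h2 := (tendsto_const_nhds (x := (1 : ℝ))).div
      ((hG (n + 1) (by omega)).const_add (x * c n)) hpos.ne'
    have h3 : G n = 1 / (x * c n + G (n + 1)) := by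
      refine tendsto_nhds_unique h1 (h2.congr fun k => ?_)
      exact (cfrac_map_range_succ (fun j => x * c j) n (k + 1)).symm
    rw [h3, one_div_mul_cancel hpos.ne']
  set L := Real.sqrt ((x / 2) ^ 2 + 1) - x / 2 with hL
  have hsq : Real.sqrt ((x / 2) ^ 2 + 1) ^ 2 = (x / 2) ^ 2 + 1 := Real.sq_sqrt (by positivity)
  have hL0 : 0 < L := sub_pos.mpr (Real.lt_sqrt_of_sq_lt (by linarith))
  have hLrec : L * (x + L) = 1 := by rw [hL]; linear_combination hsq
  have hL1 : L ^ 2 < 1 := by nlinarith [mul_pos hL0 hx]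
  have hstep : ∀ n, 1 ≤ n → |G n - L| = L * G n * |x * (1 - c n) - (G (n + 1) - L)| := by
    intro n hn
    rw [← abs_of_nonneg (mul_nonneg hL0.le (hnonneg n hn)), ← abs_mul]
    congr 1
    linear_combination (-G n) * hLrec + L * hrec n hn
  have hGle : ∀ᶠ n in atTop, G n ≤ 2 / x := by
    filter_upwards [eventually_ge_atTop 1,
      hlim.eventually_const_lt (show (1 / 2 : ℝ) < 1 by norm_num)] with n hn hcn
    rw [le_div_iff₀ hx]
    have h0 := hnonneg n hn
    have h1 := hnonneg (n + 1) (by omega)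
    nlinarith [hrec n hn, mul_nonneg h0 h1,
      mul_nonneg (mul_nonneg h0 hx.le) (sub_nonneg.mpr hcn.le)]
  have herr : Tendsto (fun n => |x * (1 - c n)|) atTop (𝓝 0) := by
    simpa using ((hlim.const_sub 1).const_mul x).abs
  have hd : Tendsto (fun n => |G n - L|) atTop (𝓝 0) := by
    refine tendsto_zero_of_le_add_mul (m := 2) (B := 2 / x + L) (q := L ^ 2)
      (e := fun n => L * (2 / x) * |x * (1 - c n)| + L ^ 2 * |x * (1 - c (n + 1))|)
      (sq_nonneg L) hL1 (fun n => abs_nonneg _) ?_ ?_ ?_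
    · filter_upwards [hGle, eventually_ge_atTop 1] with n hn h1
      have := hnonneg n h1
      rw [abs_le]
      constructor <;> linarith [div_pos two_pos hx]
    · simpa using (herr.const_mul (L * (2 / x))).add
        ((herr.comp (tendsto_add_atTop_nat 1)).const_mul (L ^ 2))
    · filter_upwards [hGle, eventually_ge_atTop 1] with n hn h1
      have hG0 := hnonneg n h1
      have hG1 := hnonneg (n + 1) (by omega)
      have hprod : G n * G (n + 1) ≤ 1 := by
        nlinarith [hrec n h1, mul_nonneg hG0 (mul_pos hx (hc n h1)).le]
      calc |G n - L| = L * G n * |x * (1 - c n) - (G (n + 1) - L)| := hstep n h1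
        _ ≤ L * G n * (|x * (1 - c n)| + |G (n + 1) - L|) := by
          gcongr; exact abs_sub _ _
        _ = L * G n * |x * (1 - c n)| + L ^ 2 * (G n * G (n + 1)) *
              |x * (1 - c (n + 1)) - (G (n + 2) - L)| := by
          rw [hstep (n + 1) (by omega)]; ring
        _ ≤ L * (2 / x) * |x * (1 - c n)| + L ^ 2 * 1 *
              (|x * (1 - c (n + 1))| + |G (n + 2) - L|) := by
          gcongr; exact abs_sub _ _
        _ = _ := by ring
  exact tendsto_iff_norm_sub_tendsto_zero.mpr hd
end

section
/- Let (c_k)_{k≥1} be a sequence of positive reals with c_k → 1 as k → ∞, and suppose that for each x > 0 the truncated continued fractions G^{(k)}(x) = [x·c₁, x·c₂, …, x·c_k] converge as k → ∞ to a limit G(x). Then G(x) → 1 as x → 0⁺. -/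
open Filter Topology

/-- The continued fraction `[a₁, …, a_k + t]`, that is, `cfrac` with tail `t` in place of `0`. -/
noncomputable def cfracTail (l : List ℝ) (t : ℝ) : ℝ :=
  l.foldr (fun a s => 1 / (a + s)) t

theorem cfracTail_cons (a : ℝ) (l : List ℝ) (t : ℝ) :
    cfracTail (a :: l) t = 1 / (a + cfracTail l t) := rfl

theorem cfracTail_append (l₁ l₂ : List ℝ) (t : ℝ) :
    cfracTail (l₁ ++ l₂) t = cfracTail l₁ (cfracTail l₂ t) :=
  List.foldr_append

theorem cfracTail_zero (l : List ℝ) : cfracTail l 0 = cfrac l := by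
  induction l with
  | nil => rfl
  | cons a l ih => rw [cfracTail_cons, ih, cfrac]

theorem cfracTail_nonneg {l : List ℝ} (hl : ∀ a ∈ l, 0 < a) {t : ℝ} (ht : 0 ≤ t) :
    0 ≤ cfracTail l t := by
  induction l with
  | nil => exact ht
  | cons a l ih =>
    have ha := hl a (by simp)
    have := ih fun b hb => hl b (by simp [hb])
    rw [cfracTail_cons]
    positivity

theorem cfracTail_monotoneOn_or_antitoneOn {l : List ℝ} (hl : ∀ a ∈ l, 0 < a) :
    MonotoneOn (cfracTail l) (Set.Ici 0) ∨ AntitoneOn (cfracTail l) (Set.Ici 0) := by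
  induction l with
  | nil => exact Or.inl fun _ _ _ _ h => h
  | cons a l ih =>
    have ha := hl a (by simp)
    have hl' : ∀ b ∈ l, 0 < b := fun b hb => hl b (by simp [hb])
    rcases ih hl' with h | h
    · refine Or.inr fun s hs t ht hst => ?_
      have := cfracTail_nonneg hl' hs
      exact one_div_le_one_div_of_le (by positivity) (add_le_add_right (h hs ht hst) a)
    · refine Or.inl fun s hs t ht hst => ?_
      have := cfracTail_nonneg hl' ht
      exact one_div_le_one_div_of_le (by positivity) (add_le_add_right (h hs ht hst) a)

/-- A continued fraction with nonnegative tail lies between the last two truncations. -/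
theorem cfracTail_mem_uIcc {l : List ℝ} (hl : ∀ a ∈ l, 0 < a) {a t : ℝ} (ha : 0 < a)
    (ht : 0 ≤ t) : cfracTail (l ++ [a]) t ∈ Set.uIcc (cfrac l) (cfrac (l ++ [a])) := by
  rw [← cfracTail_zero, ← cfracTail_zero, cfracTail_append, cfracTail_append]
  have h₁ : 0 ≤ cfracTail [a] t := cfracTail_nonneg (by simpa using ha) ht
  have h₂ : cfracTail [a] t ≤ cfracTail [a] 0 :=
    one_div_le_one_div_of_le (by simpa [cfracTail] using ha)
      (by simpa [cfracTail] using ht)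
  have h₃ : 0 ≤ cfracTail [a] 0 := h₁.trans h₂
  rcases cfracTail_monotoneOn_or_antitoneOn hl with h | h
  · exact Set.Icc_subset_uIcc ⟨h Set.self_mem_Ici h₁ h₁, h h₁ h₃ h₂⟩
  · exact Set.Icc_subset_uIcc' ⟨h h₁ h₃ h₂, h Set.self_mem_Ici h₁ h₁⟩

/-- If the truncations converge, changing the tail does not affect the limit. -/
theorem tendsto_cfracTail {a : ℕ → ℝ} (ha : ∀ i, 0 < a i) {g t : ℝ} (ht : 0 ≤ t)
    (h : Tendsto (fun k => cfrac ((List.range k).map a)) atTop (𝓝 g)) :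
    Tendsto (fun k => cfracTail ((List.range k).map a) t) atTop (𝓝 g) := by
  rw [← tendsto_add_atTop_iff_nat 1]
  have h' := (tendsto_add_atTop_iff_nat 1).2 h
  have hmem (k : ℕ) := cfracTail_mem_uIcc (l := (List.range k).map a)
    (by simpa using fun i _ => ha i) (ha k) ht
  refine tendsto_of_tendsto_of_tendsto_of_le_of_le
    (by simpa using h.min h') (by simpa using h.max h') (fun k => ?_) (fun k => ?_)
  · simpa [List.range_succ] using (hmem k).1
  · simpa [List.range_succ] using (hmem k).2

theorem eventually_cfracTail_mem_Icc (l : List ℝ) {r ρ : ℝ} (hr : 0 < r) (hrρ : r < ρ) :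
    ∀ᶠ x in 𝓝 (0 : ℝ), 0 ≤ x → (∀ a ∈ l, 0 ≤ a) → ∀ t ∈ Set.Icc ρ (1 / ρ),
      cfracTail (l.map (x * ·)) t ∈ Set.Icc r (1 / r) := by
  induction l generalizing r with
  | nil =>
    exact .of_forall fun x _ _ t ht =>
      ⟨hrρ.le.trans ht.1, ht.2.trans (one_div_le_one_div_of_le hr hrρ.le)⟩
  | cons a l ih =>
    obtain ⟨r', hrr', hr'⟩ := exists_between hrρ
    have hr'₀ : 0 < r' := by linarith
    have hlim : Tendsto (fun x : ℝ => x * a) (𝓝 0) (𝓝 0) :=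
      (continuous_mul_const a).tendsto' 0 0 (zero_mul a)
    have hsub : 0 < 1 / r - 1 / r' := sub_pos.2 (one_div_lt_one_div_of_lt hr hrr')
    filter_upwards [ih hr'₀ hr', hlim.eventually_lt_const hsub] with x hx hxa hx₀ hl t ht
    obtain ⟨h₁, h₂⟩ := hx hx₀ (fun b hb => hl b (by simp [hb])) t ht
    have ha : 0 ≤ x * a := mul_nonneg hx₀ (hl a (by simp))
    rw [List.map_cons, cfracTail_cons]
    constructor
    · rw [le_one_div hr (by linarith)]
      linarith
    · exact one_div_le_one_div_of_le hr (by linarith)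

theorem cfracTail_mem_Icc {q x : ℝ} (hq : 0 < q) (hx : 0 < x) (hxq : x ≤ 1 / q - q)
    {l : List ℝ} (hl : ∀ a ∈ l, a ∈ Set.Icc (x * q) (x / q)) {t : ℝ}
    (ht : t ∈ Set.Icc (q ^ 2) (1 / q ^ 2 - x / q)) :
    cfracTail l t ∈ Set.Icc (q ^ 2) (1 / q ^ 2 - x / q) := by
  induction l with
  | nil => exact ht
  | cons a l ih =>
    obtain ⟨h₁, h₂⟩ := ih fun b hb => hl b (by simp [hb])
    obtain ⟨h₃, h₄⟩ := hl a (by simp)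
    rw [cfracTail_cons]
    have hpos : 0 < x * q + q ^ 2 := by positivity
    constructor
    · rw [le_one_div (by positivity) (by linarith)]
      linarith
    · refine (one_div_le_one_div_of_le hpos (add_le_add h₃ h₁)).trans ?_
      rw [div_le_iff₀ hpos]
      have : (1 / q ^ 2 - x / q) * (x * q + q ^ 2) = 1 + x * (1 / q - q - x) := by
        field_simp
        ring
      rw [this]
      nlinarith

/-- If `c_k → 1` and `G(x) = [xc₁, xc₂, …]` converges for every `x > 0`, then
`G(x) → 1` as `x → 0⁺`. -/
theorem continued_fraction_limit_at_zero
    (c : ℕ → ℝ) (hc : ∀ k : ℕ, 1 ≤ k → 0 < c k)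
    (hlim : Tendsto c atTop (nhds 1))
    (G : ℝ → ℝ)
    (hG : ∀ x : ℝ, 0 < x →
      Tendsto (fun k : ℕ =>
          cfrac ((List.range k).map fun i => x * c (i + 1))) atTop (nhds (G x))) :
    Tendsto G (nhdsWithin 0 (Set.Ioi 0)) (nhds 1) := by
  rw [Metric.nhds_basis_closedBall.tendsto_right_iff]
  intro ε hε
  have hr : (0 : ℝ) < 1 / (1 + ε) := by positivity
  have hr₁ : 1 / (1 + ε) < 1 := (div_lt_one (by positivity)).2 (by linarith)
  obtain ⟨ρ, hrρ, hρ₁⟩ := exists_between hr₁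
  have hρ : 0 < ρ := hr.trans hrρ
  obtain ⟨q, hq, rfl⟩ : ∃ q : ℝ, 0 < q ∧ q ^ 2 = ρ :=
    ⟨√ρ, Real.sqrt_pos.2 hρ, Real.sq_sqrt hρ.le⟩
  have hq₁ : q < 1 := by nlinarith
  have hq' : 1 < 1 / q := (one_lt_div hq).2 hq₁
  obtain ⟨n, hn⟩ := eventually_atTop.1
    ((hlim.eventually_const_lt hq₁).and (hlim.eventually_lt_const hq'))
  filter_upwards [nhdsWithin_le_nhds (eventually_cfracTail_mem_Icc
      ((List.range n).map fun i => c (i + 1)) hr hrρ),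
    nhdsWithin_le_nhds (eventually_le_nhds (show 0 < 1 / q - q by linarith)),
    self_mem_nhdsWithin] with x hhead hxq (hx : 0 < x)
  have ht : q ^ 2 ∈ Set.Icc (q ^ 2) (1 / q ^ 2 - x / q) := by
    have h : 1 / q ^ 2 - x / q = (1 / q - x) / q := by field_simp
    rw [h, Set.mem_Icc, le_div_iff₀ hq]
    exact ⟨le_rfl, by nlinarith⟩
  have hlimx := (tendsto_add_atTop_iff_nat n).2 <| tendsto_cfracTail
    (fun i => mul_pos hx (hc (i + 1) (by lia))) hρ.le (hG x hx)
  have hmem : G x ∈ Set.Icc (1 / (1 + ε)) (1 / (1 / (1 + ε))) := by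
    refine isClosed_Icc.mem_of_tendsto hlimx (.of_forall fun k => ?_)
    have htail := cfracTail_mem_Icc hq hx hxq
      (l := (List.range k).map fun i => x * c (n + i + 1)) (by
        simp only [List.mem_map]
        rintro _ ⟨i, -, rfl⟩
        obtain ⟨h₁, h₂⟩ := hn (n + i + 1) (by lia)
        refine ⟨by gcongr, ?_⟩
        rw [div_eq_mul_one_div]
        gcongr) ht
    have := hhead hx.le (by simpa using fun i _ => (hc (i + 1) (by lia)).le) _
      ⟨htail.1, htail.2.trans (sub_le_self _ (by positivity))⟩
    rw [List.map_map, ← cfracTail_append] at this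
    rw [add_comm k n, List.range_add, List.map_append, List.map_map]
    exact this
  rw [one_div_one_div] at hmem
  rw [Real.closedBall_eq_Icc]
  refine ⟨le_trans ?_ hmem.1, hmem.2⟩
  rw [le_div_iff₀ (by positivity)]
  nlinarith
end
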